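/- arXiv:2004.06136 — 2 statements merged into one kernel-verified Lean document; each statement's English description precedes it below -/
import Mathlib

section
/- Let (φ, ψ) be a minimal embedding of a probabilistic model (A, A₊, u_A) into the quantum model Q_n, and let P := φ ∘ ψ* (where ψ* is the dual map of ψ under the trace identification). Then P(x∘y) = x∘P(y) for all x ∈ φ(A) and all Hermitian n×n matrices y, where x∘y := ½(xy + yx). Hence φ(A) = P(B) is closed under the Jordan product ∘. -/
open Module
open scoped ComplexOrder

/-- A probabilistic model `(A, A₊, u_A)`: a finite-dimensional real vector space `A`,
a closed generating pointed convex cone `A₊`, and an order unit `u_A ∈ A₊`. -/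
structure ProbModel (V : Type) [NormedAddCommGroup V] [NormedSpace ℝ V]
    [FiniteDimensional ℝ V] where
  pos : Set V
  unit : V
  add_mem : ∀ x ∈ pos, ∀ y ∈ pos, x + y ∈ pos
  smul_mem : ∀ c : ℝ, 0 ≤ c → ∀ x ∈ pos, c • x ∈ pos
  pointed : ∀ x ∈ pos, -x ∈ pos → x = 0
  closed : IsClosed pos
  spanning : Submodule.span ℝ pos = ⊤
  unit_mem : unit ∈ pos
  orderUnit : ∀ v : V, ∃ t : ℝ, 0 ≤ t ∧ t • unit - v ∈ pos

/-- The dual cone `A₊* = {ω ∈ A* : ω(e) ≥ 0 for all e ∈ A₊}`. -/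
def ProbModel.dualPos {V : Type} [NormedAddCommGroup V] [NormedSpace ℝ V]
    [FiniteDimensional ℝ V] (M : ProbModel V) : Set (Dual ℝ V) :=
  {ω | ∀ e ∈ M.pos, 0 ≤ ω e}

/-- An embedding `(φ, ψ)` of a probabilistic model `M` into a probabilistic model `N`. -/
structure ModelEmbedding {V W : Type} [NormedAddCommGroup V] [NormedSpace ℝ V]
    [FiniteDimensional ℝ V] [NormedAddCommGroup W] [NormedSpace ℝ W]
    [FiniteDimensional ℝ W] (M : ProbModel V) (N : ProbModel W) where
  φ : V →ₗ[ℝ] W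
  ψ : Dual ℝ V →ₗ[ℝ] Dual ℝ W
  φ_pos : ∀ a ∈ M.pos, φ a ∈ N.pos
  ψ_pos : ∀ ω ∈ M.dualPos, ψ ω ∈ N.dualPos
  φ_unit : φ M.unit = N.unit
  pairing : ∀ (ω : Dual ℝ V) (e : V), ψ ω (φ e) = ω e

/-- An embedding `(φ, ψ)` of a probabilistic model `M` into the `n`-level quantum
model `Q_n`, whose effect space is the real vector space of `n × n` complex Hermitian
matrices with the cone of positive-semidefinite matrices and unit effect `I`; the dual
is identified with the same space via the trace pairing `(ω, e) = tr(ω·e)`. -/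
structure QEmbedding {V : Type} [NormedAddCommGroup V] [NormedSpace ℝ V]
    [FiniteDimensional ℝ V] (M : ProbModel V) (n : ℕ) where
  φ : V →ₗ[ℝ] Matrix (Fin n) (Fin n) ℂ
  ψ : Dual ℝ V →ₗ[ℝ] Matrix (Fin n) (Fin n) ℂ
  φ_herm : ∀ a : V, (φ a).IsHermitian
  ψ_herm : ∀ ω : Dual ℝ V, (ψ ω).IsHermitian
  φ_pos : ∀ a ∈ M.pos, (φ a).PosSemidef
  ψ_pos : ∀ ω ∈ M.dualPos, (ψ ω).PosSemidef
  φ_unit : φ M.unit = 1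
  pairing : ∀ (ω : Dual ℝ V) (e : V), (ψ ω * φ e).trace = (ω e : ℂ)

/-- The Jordan product `x ∘ y := ½(xy + yx)` of matrices. -/
noncomputable def jordan {n : ℕ} (x y : Matrix (Fin n) (Fin n) ℂ) : Matrix (Fin n) (Fin n) ℂ :=
  (1 / 2 : ℂ) • (x * y + y * x)

namespace Matrix

variable {n : Type*}

open scoped MatrixOrder in
theorem PosSemidef.eq_zero_of_neg {A : Matrix n n ℂ} (hA : A.PosSemidef)
    (hA' : (-A).PosSemidef) : A = 0 :=
  le_antisymm (by simpa using hA'.nonneg) hA.nonneg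

variable [Fintype n]

/-- A pencil `C + t D` that is positive semidefinite for all real `t` is constant. -/
theorem eq_zero_of_forall_posSemidef_add_smul {C D : Matrix n n ℂ} (hD : D.IsHermitian)
    (h : ∀ t : ℝ, (C + t • D).PosSemidef) : D = 0 := by
  have key : ∀ v : n → ℂ, star v ⬝ᵥ (D *ᵥ v) = 0 := by
    intro v
    have him : (star v ⬝ᵥ (D *ᵥ v)).im = 0 := hD.im_star_dotProduct_mulVec_self v
    have hre : ∀ t : ℝ, 0 ≤ (star v ⬝ᵥ (C *ᵥ v)).re + t * (star v ⬝ᵥ (D *ᵥ v)).re := by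
      intro t
      have := (h t).re_dotProduct_nonneg v
      simpa [add_mulVec, smul_mulVec, dotProduct_add, dotProduct_smul] using this
    apply Complex.ext _ him
    by_contra hne
    replace hne : (star v ⬝ᵥ (D *ᵥ v)).re ≠ 0 := hne
    have := hre (-((star v ⬝ᵥ (C *ᵥ v)).re + 1) / (star v ⬝ᵥ (D *ᵥ v)).re)
    rw [div_mul_cancel₀ _ hne] at this
    linarith
  refine PosSemidef.eq_zero_of_neg (.of_dotProduct_mulVec_nonneg hD fun v => (key v).ge)
    (.of_dotProduct_mulVec_nonneg hD.neg fun v => ?_)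
  rw [neg_mulVec, dotProduct_neg, key, neg_zero]

variable [DecidableEq n]

open scoped MatrixOrder in
theorem PosSemidef.exists_eq_conjTranspose_mul_self {A : Matrix n n ℂ} (hA : A.PosSemidef) :
    ∃ B : Matrix n n ℂ, A = Bᴴ * B :=
  CStarAlgebra.nonneg_iff_eq_star_mul_self.mp hA.nonneg

theorem PosSemidef.trace_mul_nonneg {A B : Matrix n n ℂ} (hA : A.PosSemidef)
    (hB : B.PosSemidef) : 0 ≤ (A * B).trace := by
  obtain ⟨C, rfl⟩ := hB.exists_eq_conjTranspose_mul_self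
  rw [← mul_assoc, trace_mul_comm, ← mul_assoc]
  exact (hA.mul_mul_conjTranspose_same C).trace_nonneg

theorem PosSemidef.mul_eq_zero_of_trace_mul_eq_zero {A B : Matrix n n ℂ} (hA : A.PosSemidef)
    (hB : B.PosSemidef) (h : (A * B).trace = 0) : A * B = 0 := by
  obtain ⟨C, rfl⟩ := hB.exists_eq_conjTranspose_mul_self
  rw [← mul_assoc, trace_mul_comm, ← mul_assoc] at h
  have h0 := (hA.mul_mul_conjTranspose_same C).trace_eq_zero_iff.mp h
  obtain ⟨D, rfl⟩ := hA.exists_eq_conjTranspose_mul_self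
  have h1 : (D * Cᴴ)ᴴ * (D * Cᴴ) = 0 := by
    rw [conjTranspose_mul, conjTranspose_conjTranspose, ← h0]
    simp only [mul_assoc]
  rw [conjTranspose_mul_self_eq_zero] at h1
  rw [mul_assoc, ← mul_assoc D, h1, Matrix.zero_mul, Matrix.mul_zero]

theorem IsHermitian.exists_spectral_resolution {y : Matrix n n ℂ} (hy : y.IsHermitian) :
    ∃ (c : n → ℝ) (p : n → Matrix n n ℂ), (∀ i, (p i).PosSemidef) ∧ ∑ i, p i = 1 ∧
      ∑ i, c i • p i = y ∧ ∑ i, (c i ^ 2) • p i = y * y := by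
  set U : Matrix n n ℂ := (hy.eigenvectorUnitary : Matrix n n ℂ)
  have hU : Uᴴ * U = 1 := Unitary.coe_star_mul_self hy.eigenvectorUnitary
  have hU' : U * Uᴴ = 1 := Unitary.coe_mul_star_self hy.eigenvectorUnitary
  have hs : y = U * diagonal (fun i => (hy.eigenvalues i : ℂ)) * Uᴴ := by
    conv_lhs => rw [hy.spectral_theorem, Unitary.conjStarAlgAut_apply]
    rfl
  have hsum : ∀ c : n → ℝ, ∑ i, c i • (U * diagonal (Pi.single i 1) * Uᴴ)
      = U * diagonal (fun i => (c i : ℂ)) * Uᴴ := by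
    intro c
    have : diagonal (fun i => (c i : ℂ)) = ∑ i, c i • diagonal (Pi.single i (1 : ℂ)) := by
      ext j k
      rw [sum_apply]
      by_cases hjk : j = k
      · subst hjk
        simp [Pi.single_apply]
      · simp [diagonal_apply_ne _ hjk]
    rw [this, Finset.mul_sum, Finset.sum_mul]
    simp
  refine ⟨hy.eigenvalues, fun i => U * diagonal (Pi.single i 1) * Uᴴ, fun i => ?_, ?_, ?_, ?_⟩
  · refine PosSemidef.mul_mul_conjTranspose_same (PosSemidef.diagonal ?_) U
    exact Pi.single_nonneg.mpr zero_le_one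
  · simpa [hU'] using hsum fun _ => 1
  · rw [hsum, ← hs]
  · rw [hsum]
    conv_rhs => rw [hs]
    calc _ = U * (diagonal (fun i => (hy.eigenvalues i : ℂ)) *
          diagonal (fun i => (hy.eigenvalues i : ℂ))) * Uᴴ := by
            rw [diagonal_mul_diagonal]; simp [sq]
      _ = U * diagonal (fun i => (hy.eigenvalues i : ℂ)) * (Uᴴ * U) *
          diagonal (fun i => (hy.eigenvalues i : ℂ)) * Uᴴ := by
            rw [hU]; simp only [mul_assoc, Matrix.one_mul]
      _ = _ := by simp only [mul_assoc]

section PositiveMap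

variable {Q : Matrix n n ℂ →ₗ[ℝ] Matrix n n ℂ}

/-- A positive map preserves Hermitian matrices. -/
theorem IsHermitian.map_of_posSemidef (hpos : ∀ b, b.PosSemidef → (Q b).PosSemidef)
    {y : Matrix n n ℂ} (hy : y.IsHermitian) : (Q y).IsHermitian := by
  obtain ⟨c, p, hp, -, rfl, -⟩ := hy.exists_spectral_resolution
  simp only [map_sum, map_smul]
  have hQ := fun i => (hpos _ (hp i)).isHermitian.eq
  simp [IsHermitian, conjTranspose_sum, hQ]

/-- **Kadison's inequality** for positive unital maps on Hermitian matrices. -/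
theorem IsHermitian.posSemidef_map_sq_sub (hpos : ∀ b, b.PosSemidef → (Q b).PosSemidef)
    (hone : Q 1 = 1) {y : Matrix n n ℂ} (hy : y.IsHermitian) :
    (Q (y * y) - Q y * Q y).PosSemidef := by
  have hT := hy.map_of_posSemidef hpos
  obtain ⟨c, p, hp, hp1, hpy, hpyy⟩ := hy.exists_spectral_resolution
  set T := Q y with hTdef
  have h1 : ∑ i, Q (p i) = 1 := by rw [← map_sum, hp1, hone]
  have h2 : ∑ i, c i • Q (p i) = T := by rw [hTdef, ← hpy]; simp
  have h3 : ∑ i, (c i ^ 2) • Q (p i) = Q (y * y) := by rw [← hpyy]; simp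
  have hexp : Q (y * y) - T * T
      = ∑ i, (c i • 1 - T) * Q (p i) * (c i • 1 - T)ᴴ := by
    have hterm : ∀ i, (c i • 1 - T) * Q (p i) * (c i • 1 - T)ᴴ = (c i ^ 2) • Q (p i)
        - T * (c i • Q (p i)) - (c i • Q (p i)) * T + T * Q (p i) * T := by
      intro i
      have : (c i • (1 : Matrix n n ℂ) - T)ᴴ = c i • 1 - T := by
        simp [hT.eq]
      rw [this]
      simp only [sub_mul, mul_sub, smul_mul_assoc, mul_smul_comm, one_mul, mul_one, smul_sub,
        smul_smul, sq]
      abel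
    simp only [hterm, Finset.sum_add_distrib, Finset.sum_sub_distrib, ← Finset.mul_sum,
      ← Finset.sum_mul, h1, h2, h3]
    simp
  rw [hexp]
  exact posSemidef_sum _ fun i _ => (hpos _ (hp i)).mul_mul_conjTranspose_same _

theorem map_mul_self_of_faithful (hpos : ∀ b, b.PosSemidef → (Q b).PosSemidef)
    (hone : Q 1 = 1) (hidem : ∀ b, b.IsHermitian → Q (Q b) = Q b)
    (hfaith : ∀ b, b.PosSemidef → Q b = 0 → b = 0)
    {x : Matrix n n ℂ} (hx : x.IsHermitian) (hQx : Q x = x) : Q (x * x) = x * x := by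
  have h := hx.posSemidef_map_sq_sub hpos hone
  rw [hQx] at h
  have hxx : (x * x).IsHermitian := by simp [IsHermitian, hx.eq]
  refine sub_eq_zero.mp (hfaith _ h ?_)
  rw [map_sub, hidem _ hxx, sub_self]

/-- The module property of faithful positive unital projections over their range. -/
theorem map_anticommutator_of_faithful (hpos : ∀ b, b.PosSemidef → (Q b).PosSemidef)
    (hone : Q 1 = 1) (hidem : ∀ b, b.IsHermitian → Q (Q b) = Q b)
    (hfaith : ∀ b, b.PosSemidef → Q b = 0 → b = 0)
    {x y : Matrix n n ℂ} (hx : x.IsHermitian) (hQx : Q x = x) (hy : y.IsHermitian) :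
    Q (x * y + y * x) = x * Q y + Q y * x := by
  have hQy := hy.map_of_posSemidef hpos
  have hanti : ∀ {z : Matrix n n ℂ}, z.IsHermitian → (x * z + z * x).IsHermitian := by
    intro z hz
    simp [IsHermitian, hx.eq, hz.eq, add_comm]
  refine sub_eq_zero.mp (eq_zero_of_forall_posSemidef_add_smul
    (C := Q (y * y) - Q y * Q y)
    (((hanti hy).map_of_posSemidef hpos).sub (hanti hQy)) fun t => ?_)
  have htx : (t • x + y).IsHermitian := by simp [IsHermitian, hx.eq, hy.eq]
  convert htx.posSemidef_map_sq_sub hpos hone using 1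
  simp only [map_add, map_smul, hQx, add_mul, mul_add, smul_mul_assoc, mul_smul_comm,
    map_mul_self_of_faithful hpos hone hidem hfaith hx hQx, smul_sub, smul_add]
  abel

end PositiveMap

end Matrix

namespace ProbModel

variable {V : Type} [NormedAddCommGroup V] [NormedSpace ℝ V] [FiniteDimensional ℝ V]
  (M : ProbModel V)

/-- The bipolar theorem for the positive cone of a model. -/
theorem mem_pos_of_forall_dualPos {v : V} (h : ∀ ω ∈ M.dualPos, 0 ≤ ω v) : v ∈ M.pos := by
  by_contra hv
  let C : ProperCone ℝ V :=
    { carrier := M.pos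
      add_mem' := fun ha hb => M.add_mem _ ha _ hb
      zero_mem' := by simpa using M.smul_mem 0 le_rfl _ M.unit_mem
      smul_mem' := fun c _ hx => M.smul_mem c.1 c.2 _ hx
      isClosed' := M.closed }
  obtain ⟨f, hf, hfv⟩ := C.hyperplane_separation_point (x₀ := v) hv
  exact hfv.not_ge (h f.toLinearMap hf)

theorem eq_top_of_dualPos_subset {S : Submodule ℝ (Dual ℝ V)} (hS : M.dualPos ⊆ S) : S = ⊤ := by
  have hbot : S.dualCoannihilator = ⊥ := by
    refine (Submodule.eq_bot_iff _).mpr fun v hv => ?_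
    rw [Submodule.mem_dualCoannihilator] at hv
    refine M.pointed v (M.mem_pos_of_forall_dualPos fun ω hω => (hv ω (hS hω)).ge)
      (M.mem_pos_of_forall_dualPos fun ω hω => ?_)
    rw [map_neg, hv ω (hS hω), neg_zero]
  rw [← Subspace.dualCoannihilator_dualAnnihilator_eq (W := S), hbot,
    Submodule.dualAnnihilator_bot]

end ProbModel

namespace QEmbedding

variable {V : Type} [NormedAddCommGroup V] [NormedSpace ℝ V] [FiniteDimensional ℝ V]
  {M : ProbModel V}

open Matrix

/-- Compression of an embedding along an isometry `W` whose range supports all states. -/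
noncomputable def compress {n m : ℕ} (E : QEmbedding M n) (W : Matrix (Fin n) (Fin m) ℂ)
    (hW : Wᴴ * W = 1) (hψ : ∀ ω, E.ψ ω * (W * Wᴴ) = E.ψ ω) : QEmbedding M m where
  φ :=
    { toFun := fun a => Wᴴ * E.φ a * W
      map_add' := by simp [Matrix.mul_add, Matrix.add_mul]
      map_smul' := by simp }
  ψ :=
    { toFun := fun ω => Wᴴ * E.ψ ω * W
      map_add' := by simp [Matrix.mul_add, Matrix.add_mul]
      map_smul' := by simp }
  φ_herm a := isHermitian_conjTranspose_mul_mul W (E.φ_herm a)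
  ψ_herm ω := isHermitian_conjTranspose_mul_mul W (E.ψ_herm ω)
  φ_pos a ha := (E.φ_pos a ha).conjTranspose_mul_mul_same W
  ψ_pos ω hω := (E.ψ_pos ω hω).conjTranspose_mul_mul_same W
  φ_unit := by simp [E.φ_unit, hW]
  pairing ω e := by
    have hψ' : W * Wᴴ * E.ψ ω = E.ψ ω := by
      have := congrArg conjTranspose (hψ ω)
      simpa [conjTranspose_mul, (E.ψ_herm ω).eq] using this
    calc (Wᴴ * E.ψ ω * W * (Wᴴ * E.φ e * W)).trace
        = (Wᴴ * (E.ψ ω * (W * Wᴴ) * E.φ e * W)).trace := by simp only [Matrix.mul_assoc]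
      _ = (W * Wᴴ * E.ψ ω * E.φ e).trace := by
          rw [hψ, ← Matrix.mul_assoc, trace_mul_comm]
          simp only [Matrix.mul_assoc]
      _ = (ω e : ℂ) := by rw [hψ', E.pairing]

/-- In a minimal embedding, no nonzero Hermitian matrix is annihilated by every state. -/
theorem eq_zero_of_forall_mul_eq_zero {n : ℕ} (E : QEmbedding M n)
    (hmin : ∀ m < n, IsEmpty (QEmbedding M m)) {b : Matrix (Fin n) (Fin n) ℂ}
    (hb : b.IsHermitian) (h : ∀ ω, E.ψ ω * b = 0) : b = 0 := by
  by_contra hne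
  obtain ⟨i, hi⟩ := Function.ne_iff.mp (mt hb.eigenvalues_eq_zero_iff.mp hne)
  obtain _ | m := n
  · exact i.elim0
  set U : Matrix (Fin (m + 1)) (Fin (m + 1)) ℂ :=
    (hb.eigenvectorUnitary : Matrix (Fin (m + 1)) (Fin (m + 1)) ℂ) with hUdef
  have hU : Uᴴ * U = 1 := Unitary.coe_star_mul_self hb.eigenvectorUnitary
  have hU' : U * Uᴴ = 1 := Unitary.coe_mul_star_self hb.eigenvectorUnitary
  have hcol : ∀ ω, E.ψ ω *ᵥ U.col i = 0 := by
    intro ω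
    have h1 : E.ψ ω *ᵥ (b *ᵥ U.col i) = 0 := by rw [mulVec_mulVec, h, zero_mulVec]
    rw [hUdef, hb.eigenvectorUnitary_col_eq, hb.mulVec_eigenvectorBasis, mulVec_smul] at h1
    exact (smul_eq_zero.mp h1).resolve_left hi
  refine (hmin m m.lt_succ_self).false (E.compress (U.submatrix id i.succAbove) ?_ fun ω => ?_)
  · have : (Uᴴ * U).submatrix i.succAbove i.succAbove = 1 := by
      rw [hU, submatrix_one _ i.succAbove_right_injective]
    rw [← this]
    rfl
  · rw [← Matrix.mul_assoc]
    conv_rhs => rw [← Matrix.mul_one (E.ψ ω), ← hU', ← Matrix.mul_assoc]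
    ext j k
    have hji : (E.ψ ω * U) j i = 0 := congrFun (hcol ω) j
    rw [mul_apply (M := E.ψ ω * U), Fin.sum_univ_succAbove _ i, hji, zero_mul, zero_add]
    rfl

end QEmbedding

/-- For a minimal embedding `(φ, ψ)` of a model `M` into `Q_n`, with
`ψ* : B → A` the dual map of `ψ` under the trace identification (characterized by
`ω(ψ*(b)) = tr(ψ(ω)·b)` for Hermitian `b`), the projection `P := φ ∘ ψ*` satisfies
`P(x∘y) = x∘P(y)` for all `x ∈ φ(A)` and Hermitian `y`.  Hence `φ(A) = P(B)` is
closed under the Jordan product `∘`. -/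
theorem minimal_embedding_jordan {V : Type} [NormedAddCommGroup V]
    [NormedSpace ℝ V] [FiniteDimensional ℝ V] (M : ProbModel V) (n : ℕ)
    (E : QEmbedding M n)
    (hmin : ∀ m < n, IsEmpty (QEmbedding M m))
    (ψstar : Matrix (Fin n) (Fin n) ℂ →ₗ[ℝ] V)
    (hψstar : ∀ (ω : Dual ℝ V) (b : Matrix (Fin n) (Fin n) ℂ), b.IsHermitian →
      ((ω (ψstar b) : ℝ) : ℂ) = (E.ψ ω * b).trace) :
    (∀ x ∈ Set.range E.φ, ∀ y : Matrix (Fin n) (Fin n) ℂ, y.IsHermitian →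
        E.φ (ψstar (jordan x y)) = jordan x (E.φ (ψstar y)))
      ∧ Set.range E.φ
        = (fun b => E.φ (ψstar b)) '' {y : Matrix (Fin n) (Fin n) ℂ | y.IsHermitian}
      ∧ ∀ x ∈ Set.range E.φ, ∀ y ∈ Set.range E.φ, jordan x y ∈ Set.range E.φ := by
  have hret : ∀ a, ψstar (E.φ a) = a := fun a => by
    refine sub_eq_zero.mp ((Module.forall_dual_apply_eq_zero_iff ℝ _).mp fun ω => ?_)
    have := hψstar ω _ (E.φ_herm a)
    rw [E.pairing, Complex.ofReal_inj] at this
    rw [map_sub, this, sub_self]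
  have hpos : ∀ b : Matrix (Fin n) (Fin n) ℂ, b.PosSemidef → (E.φ (ψstar b)).PosSemidef :=
    fun b hb => E.φ_pos _ <| M.mem_pos_of_forall_dualPos fun ω hω => by
      have := (E.ψ_pos ω hω).trace_mul_nonneg hb
      rwa [← hψstar ω b hb.isHermitian, Complex.zero_le_real] at this
  have hone : E.φ (ψstar 1) = 1 := by rw [← E.φ_unit, hret]
  have hfaith : ∀ b : Matrix (Fin n) (Fin n) ℂ, b.PosSemidef → E.φ (ψstar b) = 0 → b = 0 := by
    intro b hb h0
    have hb0 : ψstar b = 0 := by rw [← hret (ψstar b), h0, map_zero]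
    have htop : LinearMap.ker ((LinearMap.mulRight ℝ b).comp E.ψ) = ⊤ :=
      M.eq_top_of_dualPos_subset fun ω hω =>
        (E.ψ_pos ω hω).mul_eq_zero_of_trace_mul_eq_zero hb <| by
          rw [← hψstar ω b hb.isHermitian, hb0, map_zero, Complex.ofReal_zero]
    exact E.eq_zero_of_forall_mul_eq_zero hmin hb.isHermitian
      fun ω => LinearMap.congr_fun (LinearMap.ker_eq_top.mp htop) ω
  have hmod : ∀ x ∈ Set.range E.φ, ∀ y : Matrix (Fin n) (Fin n) ℂ, y.IsHermitian →
      E.φ (ψstar (jordan x y)) = jordan x (E.φ (ψstar y)) := by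
    rintro _ ⟨a, rfl⟩ y hy
    have h := Matrix.map_anticommutator_of_faithful (Q := E.φ ∘ₗ ψstar) hpos hone
      (fun b _ => congrArg E.φ (hret _)) hfaith (E.φ_herm a) (congrArg E.φ (hret a)) hy
    have hhalf : ∀ z : Matrix (Fin n) (Fin n) ℂ, (1 / 2 : ℂ) • z = (1 / 2 : ℝ) • z := fun z => by
      ext; simp
    simp only [LinearMap.comp_apply] at h
    rw [jordan, jordan, hhalf, hhalf, map_smul, map_smul, h]
  refine ⟨hmod, ?_, ?_⟩
  · ext x
    constructor
    · rintro ⟨a, rfl⟩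
      exact ⟨E.φ a, E.φ_herm a, congrArg E.φ (hret a)⟩
    · rintro ⟨y, -, rfl⟩
      exact ⟨_, rfl⟩
  · rintro x hx _ ⟨a, rfl⟩
    refine ⟨ψstar (jordan x (E.φ a)), ?_⟩
    rw [hmod x hx _ (E.φ_herm a), hret]
end

section
/- (Corollary: decoherence) Let (φ, ψ) be a minimal embedding of a probabilistic model (A, A₊, u_A) into the quantum model Q_n, let P := φ ∘ ψ* (where ψ* is the dual map of ψ under the trace identification), and suppose the complex-linear extension Q of P to all n×n complex matrices M_n(ℂ) is completely positive: for every k ∈ ℕ, the blockwise application of Q to each n×n block of a kn×kn complex matrix maps positive-semidefinite matrices to positive-semidefinite matrices. Then A is order-isomorphic to a complex quantum model with superselection rules: there exist k ∈ ℕ, positive integers n₁, …, n_k, and a real-linear bijection T from A onto the direct sum ⨁ᵢ {nᵢ×nᵢ complex Hermitian matrices} such that T(A₊) equals the direct sum of the cones of positive-semidefinite matrices and T(u_A) equals the identity element (I_{n₁}, …, I_{n_k}). -/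
open Module
open scoped ComplexOrder

instance StarSubalgebra.finiteDimensional_matrix {n : ℕ}
    (R : StarSubalgebra ℂ (Matrix (Fin n) (Fin n) ℂ)) : FiniteDimensional ℂ R :=
  inferInstanceAs (FiniteDimensional ℂ R.toSubalgebra.toSubmodule)

/-- A `⋆`-subalgebra of a complex matrix algebra is semisimple. -/
theorem StarSubalgebra.isSemisimpleRing_of_matrix {n : ℕ}
    (R : StarSubalgebra ℂ (Matrix (Fin n) (Fin n) ℂ)) : IsSemisimpleRing R := by
  have : IsArtinianRing R := isArtinian_of_tower ℂ inferInstance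
  rw [IsArtinianRing.isSemisimpleRing_iff_jacobson, eq_bot_iff]
  intro x hx
  obtain ⟨N, hN⟩ := IsSemiprimaryRing.isNilpotent (R := R)
  have hy : star x * x ∈ Ring.jacobson R := Ideal.mul_mem_left _ _ hx
  have hy0 : IsNilpotent (star x * x) := ⟨N, by
    have := Ideal.pow_mem_pow hy N
    rw [hN] at this
    simpa using this⟩
  have h1 : IsNilpotent ((x : Matrix (Fin n) (Fin n) ℂ).conjTranspose * x) := hy0.map R.subtype
  have h2 := (Matrix.isNilpotent_trace_of_isNilpotent h1).eq_zero
  rw [Matrix.trace_conjTranspose_mul_self_eq_zero_iff] at h2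
  exact Subtype.ext h2

/-- Every `⋆`-subalgebra of `Mₙ(ℂ)` is `⋆`-isomorphic to a direct sum of full matrix algebras,
each component being given by compression to a subspace. -/
theorem StarSubalgebra.exists_starAlgEquiv_pi_matrix {n : ℕ}
    (R : StarSubalgebra ℂ (Matrix (Fin n) (Fin n) ℂ)) :
    ∃ (k : ℕ) (d : Fin k → ℕ) (_ : ∀ i, 0 < d i)
      (e : R ≃⋆ₐ[ℂ] (∀ i, Matrix (Fin (d i)) (Fin (d i)) ℂ))
      (W : ∀ i, Matrix (Fin n) (Fin (d i)) ℂ),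
      ∀ (r : R) (i : Fin k), e r i = (W i).conjTranspose * (r : Matrix (Fin n) (Fin n) ℂ) * W i := by
  have := R.isSemisimpleRing_of_matrix
  obtain ⟨k, d, hd, ⟨e₀⟩⟩ := IsSemisimpleRing.exists_algEquiv_pi_matrix_of_isAlgClosed ℂ R
  have hS : ∀ i, ∃ S : Matrix (Fin n) (Fin (d i)) ℂ, Function.Injective S.mulVec ∧
      ∀ r : R, (r : Matrix (Fin n) (Fin n) ℂ) * S = S * e₀ r i := by
    intro i
    let E : Fin (d i) → Fin (d i) → R := fun a b => e₀.symm (Pi.single i (Matrix.single a b 1))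
    have hrE : ∀ (r : R) a b, r * E a b = ∑ c, e₀ r i c a • E c b := by
      intro r a b
      apply e₀.injective
      simp only [E, map_mul, map_sum, map_smul, AlgEquiv.apply_symm_apply]
      ext j p q
      by_cases h : j = i
      · subst h
        by_cases hq : b = q <;>
        simp [Finset.sum_apply, Matrix.sum_apply, Matrix.mul_apply, Matrix.single_apply, hq]
      · simp [h, Finset.sum_apply, Matrix.sum_apply]
    let z : Fin (d i) := ⟨0, Nat.pos_of_ne_zero (hd i).out⟩
    have hz : (E z z : Matrix (Fin n) (Fin n) ℂ) ≠ 0 := by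
      intro h
      have h' : E z z = 0 := Subtype.ext h
      have := congr_fun ((map_eq_zero_iff e₀.symm e₀.symm.injective).1 h') i
      simpa using congr_fun₂ this z z
    obtain ⟨w, hw⟩ : ∃ w, (E z z : Matrix (Fin n) (Fin n) ℂ).mulVec w ≠ 0 := by
      by_contra! h
      exact hz (Matrix.ext_of_mulVec_single fun i => by rw [h, Matrix.zero_mulVec])
    let S : Matrix (Fin n) (Fin (d i)) ℂ :=
      Matrix.of fun p a => ((E a z : Matrix (Fin n) (Fin n) ℂ).mulVec w) p
    have hSr : ∀ r : R, (r : Matrix (Fin n) (Fin n) ℂ) * S = S * e₀ r i := by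
      intro r
      ext p a
      have h1 := congr_arg (fun x : R => (x : Matrix (Fin n) (Fin n) ℂ).mulVec w p) (hrE r a z)
      simp only [MulMemClass.coe_mul, AddSubmonoidClass.coe_finsetSum, ← Matrix.mulVec_mulVec,
        Matrix.sum_mulVec, Finset.sum_apply] at h1
      rw [Matrix.mul_apply, Matrix.mul_apply]
      refine h1.trans (Finset.sum_congr rfl fun c _ => ?_)
      simp [S, Matrix.smul_mulVec, mul_comm]
    refine ⟨S, ?_, hSr⟩
    rw [← Matrix.coe_mulVecLin, injective_iff_map_eq_zero]
    intro c hc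
    rw [Matrix.mulVecLin_apply] at hc
    ext b
    have h1 := congr_arg (fun X => X.mulVec c) (hSr (E z b))
    simp only [← Matrix.mulVec_mulVec, hc, Matrix.mulVec_zero] at h1
    have h2 : (e₀ (E z b) i).mulVec c = c b • Pi.single z 1 := by
      ext a
      by_cases ha : z = a <;>
      simp [E, Matrix.mulVec, dotProduct, Matrix.single_apply, ha]
    rw [h2, Matrix.mulVec_smul] at h1
    refine (smul_eq_zero.1 h1.symm).resolve_right fun h => hw ?_
    ext p
    simpa [S] using congr_fun h p
  choose S hSi hSr using hS
  have hC : ∀ i, ∃ C : (Matrix (Fin (d i)) (Fin (d i)) ℂ)ˣ,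
      C.val.conjTranspose * C.val = (S i).conjTranspose * S i := by
    intro i
    have hG := Matrix.PosDef.conjTranspose_mul_self _ (hSi i)
    open scoped MatrixOrder Matrix.Norms.L2Operator in
    obtain ⟨C, hC⟩ := CStarAlgebra.nonneg_iff_eq_star_mul_self.mp hG.posSemidef.nonneg
    have hu : IsUnit C := by
      have := hG.isUnit
      rw [hC, Matrix.isUnit_iff_isUnit_det, Matrix.det_mul] at this
      exact (Matrix.isUnit_iff_isUnit_det _).2 (isUnit_of_mul_isUnit_right this)
    exact ⟨hu.unit, hC.symm⟩
  choose C hC using hC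
  let W : ∀ i, Matrix (Fin n) (Fin (d i)) ℂ := fun i => S i * (C i)⁻¹.val
  let conj : ∀ i, Matrix (Fin (d i)) (Fin (d i)) ℂ ≃ₐ[ℂ] Matrix (Fin (d i)) (Fin (d i)) ℂ := fun i =>
    MulSemiringAction.toAlgEquiv ℂ (Matrix (Fin (d i)) (Fin (d i)) ℂ) (ConjAct.toConjAct (C i))
  let e₁ : R ≃ₐ[ℂ] (∀ i, Matrix (Fin (d i)) (Fin (d i)) ℂ) :=
    e₀.trans (AlgEquiv.piCongrRight conj)
  have he₁ : ∀ (r : R) i, e₁ r i = (W i).conjTranspose * (r : Matrix (Fin n) (Fin n) ℂ) * W i := by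
    intro r i
    have h1 : e₁ r i = (C i).val * e₀ r i * (C i)⁻¹.val := rfl
    have h2 : (C i)⁻¹.val.conjTranspose * (C i).val.conjTranspose = 1 := by
      rw [← Matrix.conjTranspose_mul]; simp
    calc e₁ r i = ((C i)⁻¹.val.conjTranspose * (C i).val.conjTranspose)
          * (C i).val * e₀ r i * (C i)⁻¹.val := by rw [h1, h2, one_mul]
      _ = (C i)⁻¹.val.conjTranspose * ((C i).val.conjTranspose * (C i).val)
          * e₀ r i * (C i)⁻¹.val := by simp only [mul_assoc]
      _ = (C i)⁻¹.val.conjTranspose * (S i).conjTranspose * (S i * e₀ r i)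
          * (C i)⁻¹.val := by rw [hC]; simp only [Matrix.mul_assoc]
      _ = _ := by
        rw [← hSr]; simp only [W, Matrix.conjTranspose_mul]; simp only [Matrix.mul_assoc]
  refine ⟨k, d, fun i => Nat.pos_of_ne_zero (hd i).out, .ofAlgEquiv e₁ fun r => ?_, W, he₁⟩
  ext1 i
  rw [Pi.star_apply, he₁, he₁, Matrix.star_eq_conjTranspose]
  simp [Matrix.mul_assoc, Matrix.star_eq_conjTranspose]

/-- A closed cone is determined by its dual cone. -/
theorem ProbModel.mem_pos_of_forall_dualPos_s18 {V : Type} [NormedAddCommGroup V] [NormedSpace ℝ V]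
    [FiniteDimensional ℝ V] (M : ProbModel V) {v : V} (h : ∀ ω ∈ M.dualPos, 0 ≤ ω v) :
    v ∈ M.pos := by
  by_contra hv
  let C : ProperCone ℝ V :=
    { carrier := M.pos
      add_mem' := fun {x y} hx hy => M.add_mem x hx y hy
      zero_mem' := by simpa using M.smul_mem 0 le_rfl _ M.unit_mem
      smul_mem' := fun c x hx => M.smul_mem c c.2 x hx
      isClosed' := M.closed }
  obtain ⟨f, hf, hfv⟩ := C.hyperplane_separation_point (x₀ := v) hv
  exact hfv.not_ge (h f.toLinearMap fun e he => hf e he)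

/-- The dual cone of a model spans the dual space. -/
theorem ProbModel.span_dualPos {V : Type} [NormedAddCommGroup V] [NormedSpace ℝ V]
    [FiniteDimensional ℝ V] (M : ProbModel V) : Submodule.span ℝ M.dualPos = ⊤ := by
  have h : (Submodule.span ℝ M.dualPos).dualCoannihilator = ⊥ := by
    rw [eq_bot_iff]
    intro v hv
    rw [Submodule.mem_dualCoannihilator] at hv
    have h0 : ∀ ω ∈ M.dualPos, ω v = 0 := fun ω hω => hv ω (Submodule.subset_span hω)
    exact M.pointed v (M.mem_pos_of_forall_dualPos_s18 fun ω hω => (h0 ω hω).ge)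
      (M.mem_pos_of_forall_dualPos_s18 fun ω hω => by simp [h0 ω hω])
  rw [← Subspace.dualCoannihilator_dualAnnihilator_eq (W := Submodule.span ℝ M.dualPos), h,
    Submodule.dualAnnihilator_bot]

/-- The trace pairing of positive semidefinite matrices is nonnegative. -/
theorem Matrix.PosSemidef.trace_mul_nonneg_s18 {ι : Type*} [Fintype ι] [DecidableEq ι]
    {A B : Matrix ι ι ℂ} (hA : A.PosSemidef) (hB : B.PosSemidef) : 0 ≤ (A * B).trace := by
  open scoped MatrixOrder Matrix.Norms.L2Operator in
  obtain ⟨C, rfl⟩ := CStarAlgebra.nonneg_iff_eq_star_mul_self.mp hA.nonneg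
  rw [Matrix.mul_assoc, Matrix.trace_mul_comm]
  exact (hB.mul_mul_conjTranspose_same C).trace_nonneg

/-- Positive semidefinite matrices that are orthogonal for the trace pairing have product zero. -/
theorem Matrix.PosSemidef.mul_eq_zero_of_trace_mul_eq_zero_s18 {ι : Type*} [Fintype ι] [DecidableEq ι]
    {A B : Matrix ι ι ℂ} (hA : A.PosSemidef) (hB : B.PosSemidef) (h : (A * B).trace = 0) :
    A * B = 0 := by
  open scoped MatrixOrder Matrix.Norms.L2Operator in
  obtain ⟨C, rfl⟩ := CStarAlgebra.nonneg_iff_eq_star_mul_self.mp hA.nonneg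
  open scoped MatrixOrder Matrix.Norms.L2Operator in
  obtain ⟨D, rfl⟩ := CStarAlgebra.nonneg_iff_eq_star_mul_self.mp hB.nonneg
  simp only [Matrix.star_eq_conjTranspose] at h ⊢
  have h1 : ((C * D.conjTranspose) * (C * D.conjTranspose).conjTranspose).trace = 0 := by
    rw [← h, Matrix.mul_assoc C.conjTranspose, Matrix.trace_mul_comm C.conjTranspose]
    simp [Matrix.mul_assoc]
  rw [Matrix.trace_mul_conjTranspose_self_eq_zero_iff] at h1
  calc C.conjTranspose * C * (D.conjTranspose * D)
      = C.conjTranspose * (C * D.conjTranspose) * D := by simp only [Matrix.mul_assoc]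
    _ = 0 := by simp [h1]

/-- In a minimal embedding the matrices `ψ ω` have no common kernel. -/
theorem QEmbedding.eq_zero_of_forall_ψ_mul_eq_zero {V : Type} [NormedAddCommGroup V]
    [NormedSpace ℝ V] [FiniteDimensional ℝ V] {M : ProbModel V} {n : ℕ} (E : QEmbedding M n)
    (hmin : ∀ m < n, IsEmpty (QEmbedding M m)) {x : Matrix (Fin n) (Fin n) ℂ}
    (hx : x.IsHermitian) (h : ∀ ω, E.ψ ω * x = 0) : x = 0 := by
  by_contra hx0
  obtain ⟨i, hi⟩ : ∃ i, hx.eigenvalues i ≠ 0 := by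
    by_contra! hc
    exact hx0 (hx.eigenvalues_eq_zero_iff.1 (funext hc))
  obtain _ | m := n
  · exact i.elim0
  let U : Matrix (Fin (m + 1)) (Fin (m + 1)) ℂ := hx.eigenvectorUnitary
  have hU1 : U.conjTranspose * U = 1 := Unitary.coe_star_mul_self hx.eigenvectorUnitary
  have hU2 : U * U.conjTranspose = 1 := Unitary.coe_mul_star_self hx.eigenvectorUnitary
  have hcol : ∀ ω p, (E.ψ ω * U) p i = 0 := by
    intro ω p
    have h1 : x.mulVec (U.col i) = hx.eigenvalues i • U.col i := by
      have := hx.mulVec_eigenvectorBasis i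
      rwa [← hx.eigenvectorUnitary_col_eq] at this
    have h2 : (E.ψ ω).mulVec (x.mulVec (U.col i)) = 0 := by
      rw [Matrix.mulVec_mulVec, h, Matrix.zero_mulVec]
    rw [h1, Matrix.mulVec_smul] at h2
    exact congr_fun ((smul_eq_zero.1 h2).resolve_left hi) p
  let W : Matrix (Fin (m + 1)) (Fin m) ℂ := U.submatrix id i.succAbove
  have hW1 : W.conjTranspose * W = 1 := by
    have : W.conjTranspose * W = (U.conjTranspose * U).submatrix i.succAbove i.succAbove := by
      ext a b
      simp [W, Matrix.mul_apply]
    rw [this, hU1, Matrix.submatrix_one _ Fin.succAbove_right_injective]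
  have hψW : ∀ ω, E.ψ ω * (W * W.conjTranspose) = E.ψ ω := by
    intro ω
    have : E.ψ ω * U * U.conjTranspose = E.ψ ω := by rw [Matrix.mul_assoc, hU2, mul_one]
    rw [← Matrix.mul_assoc]
    conv_rhs => rw [← this]
    ext p q
    rw [Matrix.mul_apply, Matrix.mul_apply, Fin.sum_univ_succAbove _ i, hcol, zero_mul, zero_add]
    rfl
  have hWψ : ∀ ω, W * W.conjTranspose * E.ψ ω = E.ψ ω := by
    intro ω
    have := congr_arg Matrix.conjTranspose (hψW ω)
    simpa [(E.ψ_herm ω).eq] using this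
  let L : Matrix (Fin (m + 1)) (Fin (m + 1)) ℂ →ₗ[ℝ] Matrix (Fin m) (Fin m) ℂ :=
    { toFun := fun y => W.conjTranspose * y * W
      map_add' := fun y z => by rw [Matrix.mul_add, Matrix.add_mul]
      map_smul' := fun c y => by simp }
  have hL : ∀ y, L y = W.conjTranspose * y * W := fun _ => rfl
  refine (hmin m (Nat.lt_succ_self m)).false
    { φ := L ∘ₗ E.φ
      ψ := L ∘ₗ E.ψ
      φ_herm := fun a => Matrix.isHermitian_conjTranspose_mul_mul W (E.φ_herm a)
      ψ_herm := fun ω => Matrix.isHermitian_conjTranspose_mul_mul W (E.ψ_herm ω)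
      φ_pos := fun a ha => (E.φ_pos a ha).conjTranspose_mul_mul_same W
      ψ_pos := fun ω hω => (E.ψ_pos ω hω).conjTranspose_mul_mul_same W
      φ_unit := by simp [hL, E.φ_unit, hW1]
      pairing := fun ω e => ?_ }
  rw [← E.pairing, LinearMap.comp_apply, LinearMap.comp_apply, hL, hL]
  calc (W.conjTranspose * E.ψ ω * W * (W.conjTranspose * E.φ e * W)).trace
      = (W.conjTranspose * (E.ψ ω * (W * W.conjTranspose) * E.φ e * W)).trace := by
        simp only [Matrix.mul_assoc]
    _ = (E.ψ ω * E.φ e * W * W.conjTranspose).trace := by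
        rw [hψW, Matrix.trace_mul_comm]
    _ = (W * W.conjTranspose * E.ψ ω * E.φ e).trace := by
        rw [Matrix.mul_assoc _ W, Matrix.trace_mul_comm, ← Matrix.mul_assoc]
    _ = _ := by rw [hWψ]

/-- The **Kadison–Schwarz inequality** for a unital map that is `2`-positive. -/
theorem Matrix.posSemidef_map_sub_of_two_positive {n : ℕ}
    {Q : Matrix (Fin n) (Fin n) ℂ →ₗ[ℂ] Matrix (Fin n) (Fin n) ℂ} (h1 : Q 1 = 1)
    (hstar : ∀ x, Q x.conjTranspose = (Q x).conjTranspose)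
    (hQ : ∀ Mk : Matrix (Fin 2 × Fin n) (Fin 2 × Fin n) ℂ, Mk.PosSemidef →
      (Matrix.of fun p q : Fin 2 × Fin n =>
        Q (Matrix.of fun a b : Fin n => Mk (p.1, a) (q.1, b)) p.2 q.2).PosSemidef)
    (x : Matrix (Fin n) (Fin n) ℂ) :
    (Q (x.conjTranspose * x) - (Q x).conjTranspose * Q x).PosSemidef := by
  let B : Matrix (Fin n) (Fin 2 × Fin n) ℂ := Matrix.of fun a p => (![1, x] p.1) a p.2
  let D : Matrix (Fin 2 × Fin n) (Fin n) ℂ := Matrix.of fun p b => (![-Q x, 1] p.1) p.2 b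
  have hB : ∀ i j, (Matrix.of fun a b : Fin n => (B.conjTranspose * B) (i, a) (j, b)) =
      (![1, x] i).conjTranspose * ![1, x] j := by
    intro i j
    ext a b
    simp [B, Matrix.mul_apply]
  have h := (hQ _ (Matrix.posSemidef_conjTranspose_mul_self B)).conjTranspose_mul_mul_same D
  simp only [hB] at h
  convert h using 1
  have key : ∀ F : Fin 2 → Fin 2 → Matrix (Fin n) (Fin n) ℂ,
      D.conjTranspose * (Matrix.of fun p q : Fin 2 × Fin n => F p.1 q.1 p.2 q.2) * D =
        ∑ i, ∑ j, (![-Q x, 1] i).conjTranspose * F i j * ![-Q x, 1] j := by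
    intro F
    ext a b
    simp only [Matrix.mul_apply, Matrix.add_apply, Fintype.sum_prod_type, Fin.sum_univ_two, D,
      Matrix.conjTranspose_apply, Matrix.of_apply, Finset.sum_add_distrib, add_mul]
    ring
  rw [key fun i j => Q ((![1, x] i).conjTranspose * ![1, x] j)]
  simp only [Fin.sum_univ_two, Matrix.cons_val_zero, Matrix.cons_val_one,
    Matrix.conjTranspose_neg, Matrix.conjTranspose_one, one_mul, mul_one, h1, hstar]
  noncomm_ring

/-- The range of a faithful unital idempotent map satisfying the Kadison–Schwarz inequality is a
`⋆`-subalgebra. -/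
noncomputable def Matrix.rangeStarSubalgebra {n : ℕ}
    (Q : Matrix (Fin n) (Fin n) ℂ →ₗ[ℂ] Matrix (Fin n) (Fin n) ℂ) (h1 : Q 1 = 1)
    (hstar : ∀ x, Q x.conjTranspose = (Q x).conjTranspose) (hidem : ∀ x, Q (Q x) = Q x)
    (hschwarz : ∀ x, (Q (x.conjTranspose * x) - (Q x).conjTranspose * Q x).PosSemidef)
    (hfaith : ∀ x : Matrix (Fin n) (Fin n) ℂ, x.PosSemidef → Q x = 0 → x = 0) :
    StarSubalgebra ℂ (Matrix (Fin n) (Fin n) ℂ) where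
  carrier := {x | Q x = x}
  add_mem' := fun {x y} hx hy => by
    simp only [Set.mem_ofPred_eq] at hx hy ⊢
    rw [map_add, hx, hy]
  mul_mem' := fun {x y} hx hy => by
    simp only [Set.mem_ofPred_eq] at hx hy ⊢
    have hsq : ∀ z, Q z = z → Q (z.conjTranspose * z) = z.conjTranspose * z := by
      intro z hz
      have h := hschwarz z
      rw [hz] at h
      exact sub_eq_zero.1 (hfaith _ h (by rw [map_sub, hidem, sub_self]))
    have hx' : Q x.conjTranspose = x.conjTranspose := by rw [hstar, hx]
    have e1 := hsq (x.conjTranspose + y) (by rw [map_add, hx', hy])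
    have e2 := hsq (x.conjTranspose - y) (by rw [map_sub, hx', hy])
    have e3 := hsq (x.conjTranspose + Complex.I • y) (by rw [map_add, map_smul, hx', hy])
    have e4 := hsq (x.conjTranspose - Complex.I • y) (by rw [map_sub, map_smul, hx', hy])
    have polar : x * y = (1 / 4 : ℂ) •
        ((x.conjTranspose + y).conjTranspose * (x.conjTranspose + y)
        - (x.conjTranspose - y).conjTranspose * (x.conjTranspose - y)
        - Complex.I • ((x.conjTranspose + Complex.I • y).conjTranspose *
            (x.conjTranspose + Complex.I • y)
          - (x.conjTranspose - Complex.I • y).conjTranspose *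
            (x.conjTranspose - Complex.I • y))) := by
      simp only [Matrix.conjTranspose_add, Matrix.conjTranspose_sub, Matrix.conjTranspose_smul,
        Matrix.conjTranspose_conjTranspose, mul_add, add_mul, mul_sub, sub_mul, Matrix.smul_mul,
        Matrix.mul_smul, smul_add, smul_sub, smul_smul]
      simp
      module
    rw [polar]
    simp only [map_smul, map_sub] at e1 e2 e3 e4 ⊢
    rw [e1, e2, e3, e4]
  algebraMap_mem' := fun c => by
    simp only [Set.mem_ofPred_eq]
    rw [Algebra.algebraMap_eq_smul_one, map_smul, h1]
  star_mem' := fun {x} hx => by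
    simp only [Set.mem_ofPred_eq] at hx ⊢
    rw [Matrix.star_eq_conjTranspose, hstar, hx]

/-- **Corollary: decoherence.** Let `(φ, ψ)` be a minimal embedding of
a model `M` into `Q_n`, `ψ*` the dual map of `ψ` under the trace identification
(characterized by `ω(ψ*(b)) = tr(ψ(ω)·b)` for Hermitian `b`), `P := φ ∘ ψ*`, and
suppose the complex-linear extension `Q` of `P` to `M_n(ℂ)` is completely positive
(blockwise application of `Q` to `kn × kn` matrices preserves positive
semidefiniteness for every `k`).  Then `A` is order-isomorphic to a complex quantum
model with superselection rules: a direct sum `⨁ᵢ Herm(nᵢ)` with the direct sum of the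
positive-semidefinite cones and unit `(I_{n₁}, …, I_{n_k})`. -/
theorem decoherence_superselection {V : Type} [NormedAddCommGroup V]
    [NormedSpace ℝ V] [FiniteDimensional ℝ V] (M : ProbModel V) (n : ℕ)
    (E : QEmbedding M n)
    (hmin : ∀ m < n, IsEmpty (QEmbedding M m))
    (ψstar : Matrix (Fin n) (Fin n) ℂ →ₗ[ℝ] V)
    (hψstar : ∀ (ω : Dual ℝ V) (b : Matrix (Fin n) (Fin n) ℂ), b.IsHermitian →
      ((ω (ψstar b) : ℝ) : ℂ) = (E.ψ ω * b).trace)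
    (Q : Matrix (Fin n) (Fin n) ℂ →ₗ[ℂ] Matrix (Fin n) (Fin n) ℂ)
    (hQext : ∀ y : Matrix (Fin n) (Fin n) ℂ, y.IsHermitian → Q y = E.φ (ψstar y))
    (hQcp : ∀ (k : ℕ) (Mk : Matrix (Fin k × Fin n) (Fin k × Fin n) ℂ),
      Mk.PosSemidef →
        (Matrix.of fun p q : Fin k × Fin n =>
          Q (Matrix.of fun a b : Fin n => Mk (p.1, a) (q.1, b)) p.2 q.2).PosSemidef) :
    ∃ (k : ℕ) (d : Fin k → ℕ), (∀ i, 0 < d i) ∧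
      ∃ T : V →ₗ[ℝ] (∀ i, Matrix (Fin (d i)) (Fin (d i)) ℂ),
        Function.Injective T
        ∧ Set.range T = {x : ∀ i, Matrix (Fin (d i)) (Fin (d i)) ℂ |
            ∀ i, (x i).IsHermitian}
        ∧ T M.unit = 1
        ∧ T '' M.pos = {x : ∀ i, Matrix (Fin (d i)) (Fin (d i)) ℂ |
            ∀ i, (x i).PosSemidef} := by
  have hψφ : ∀ v, ψstar (E.φ v) = v := by
    intro v
    rw [← sub_eq_zero, ← Module.forall_dual_apply_eq_zero_iff ℝ]
    intro ω
    have h := hψstar ω _ (E.φ_herm v)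
    rw [E.pairing] at h
    rw [map_sub, sub_eq_zero]
    exact_mod_cast h
  have hφinj : Function.Injective E.φ := Function.LeftInverse.injective hψφ
  have hψpos : ∀ b : Matrix (Fin n) (Fin n) ℂ, b.PosSemidef → ψstar b ∈ M.pos := by
    intro b hb
    refine M.mem_pos_of_forall_dualPos_s18 fun ω hω => ?_
    have h := hb.trace_mul_nonneg_s18 (E.ψ_pos ω hω)
    rw [Matrix.trace_mul_comm, ← hψstar ω b hb.isHermitian] at h
    exact_mod_cast h
  have hdecomp : ∀ x : Matrix (Fin n) (Fin n) ℂ, ∃ a b : Matrix (Fin n) (Fin n) ℂ,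
      a.IsHermitian ∧ b.IsHermitian ∧ x = a + Complex.I • b := fun x =>
    ⟨realPart x, imaginaryPart x, (realPart x).2, (imaginaryPart x).2,
      (realPart_add_I_smul_imaginaryPart x).symm⟩
  have hQφ : ∀ v, Q (E.φ v) = E.φ v := fun v => by rw [hQext _ (E.φ_herm v), hψφ]
  have hQ1 : Q 1 = 1 := by rw [← E.φ_unit, hQφ]
  have hidem : ∀ x, Q (Q x) = Q x := by
    intro x
    obtain ⟨a, b, ha, hb, rfl⟩ := hdecomp x
    simp only [map_add, map_smul, hQext a ha, hQext b hb, hQφ]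
  have hstar : ∀ x, Q x.conjTranspose = (Q x).conjTranspose := by
    intro x
    obtain ⟨a, b, ha, hb, rfl⟩ := hdecomp x
    simp only [Matrix.conjTranspose_add, Matrix.conjTranspose_smul, map_add, map_smul, ha.eq,
      hb.eq, hQext a ha, hQext b hb, (E.φ_herm _).eq]
  have hfaith : ∀ x : Matrix (Fin n) (Fin n) ℂ, x.PosSemidef → Q x = 0 → x = 0 := by
    intro x hx hQx
    rw [hQext x hx.isHermitian, map_eq_zero_iff _ hφinj] at hQx
    refine E.eq_zero_of_forall_ψ_mul_eq_zero hmin hx.isHermitian fun ω => ?_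
    have hω : ω ∈ Submodule.span ℝ M.dualPos := M.span_dualPos ▸ Submodule.mem_top
    induction hω using Submodule.span_induction with
    | mem ω hω =>
      refine (E.ψ_pos ω hω).mul_eq_zero_of_trace_mul_eq_zero_s18 hx ?_
      rw [← hψstar ω x hx.isHermitian, hQx, map_zero, Complex.ofReal_zero]
    | zero => simp
    | add a b _ _ ha hb => rw [map_add, add_mul, ha, hb, add_zero]
    | smul c a _ ha => rw [map_smul, Matrix.smul_mul, ha, smul_zero]
  let R := Matrix.rangeStarSubalgebra Q hQ1 hstar hidem
    (Matrix.posSemidef_map_sub_of_two_positive hQ1 hstar (hQcp 2)) hfaith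
  obtain ⟨k, d, hd, e, W, heW⟩ := R.exists_starAlgEquiv_pi_matrix
  have hherm : ∀ r : R, (r : Matrix (Fin n) (Fin n) ℂ).IsHermitian →
      E.φ (ψstar r) = r := fun r hr => (hQext _ hr).symm.trans r.2
  let φR : V →ₗ[ℝ] R :=
    { toFun := fun v => ⟨E.φ v, hQφ v⟩
      map_add' := fun v w => Subtype.ext (map_add E.φ v w)
      map_smul' := fun c v => Subtype.ext (map_smul E.φ c v) }
  let T : V →ₗ[ℝ] (∀ i, Matrix (Fin (d i)) (Fin (d i)) ℂ) :=
    { toFun := fun v => e (φR v)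
      map_add' := fun v w => by rw [map_add, map_add]
      map_smul' := fun c v => by
        rw [map_smul]
        exact map_smul e (c : ℂ) (φR v) }
  refine ⟨k, d, hd, T, fun v w h => ?_, ?_, ?_, ?_⟩
  · exact hφinj (congr_arg Subtype.val (e.injective h))
  · ext x
    constructor
    · rintro ⟨v, rfl⟩ i
      exact heW (φR v) i ▸ Matrix.isHermitian_conjTranspose_mul_mul _ (E.φ_herm v)
    · intro hx
      have hs : star (e.symm x) = e.symm x := by
        rw [← map_star]
        exact congr_arg _ (funext hx)
      refine ⟨ψstar (e.symm x), ?_⟩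
      have : φR (ψstar (e.symm x)) = e.symm x :=
        Subtype.ext (hherm _ (congr_arg Subtype.val hs))
      exact (congr_arg e this).trans (e.apply_symm_apply x)
  · have : φR M.unit = 1 := Subtype.ext E.φ_unit
    exact (congr_arg e this).trans (map_one e)
  · ext x
    constructor
    · rintro ⟨v, hv, rfl⟩ i
      exact heW (φR v) i ▸ (E.φ_pos v hv).conjTranspose_mul_mul_same _
    · intro hx
      have hsq : ∀ i, ∃ y : Matrix (Fin (d i)) (Fin (d i)) ℂ, x i = star y * y := fun i => by
        open scoped MatrixOrder Matrix.Norms.L2Operator in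
        exact CStarAlgebra.nonneg_iff_eq_star_mul_self.mp (hx i).nonneg
      choose y hy using hsq
      have hxy : e.symm x = star (e.symm y) * e.symm y := by
        rw [← map_star, ← map_mul]
        exact congr_arg _ (funext hy)
      have hpos : (e.symm x : Matrix (Fin n) (Fin n) ℂ).PosSemidef := by
        rw [hxy]
        exact Matrix.posSemidef_conjTranspose_mul_self _
      refine ⟨ψstar (e.symm x), hψpos _ hpos, ?_⟩
      have : φR (ψstar (e.symm x)) = e.symm x := Subtype.ext (hherm _ hpos.isHermitian)
      exact (congr_arg e this).trans (e.apply_symm_apply x)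
end
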